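/- Let B ⊆ ℝ³ be open and contractible, and let T be a smooth symmetric (²₀)-tensor field on B (T^{IJ} = T^{JI}) with div T = 0, i.e. ∂_J T^{IJ} = 0 on B for all I. Then there exists a smooth symmetric (²₀)-tensor field Φ : B → ℝ^{3×3} (Φ^{IJ} = Φ^{JI}, a Beltrami stress function) such that T = curl∘curl Φ, i.e. T^{IJ} = ε_{IKL} ε_{JMN} ∂_K ∂_M Φ^{LN} on B for all I, J. -/

import Mathlib

/-- Partial derivative in the `K`-th coordinate direction. -/
noncomputable def pd {n : ℕ} (K : Fin n) (f : (Fin n → ℝ) → ℝ) (x : Fin n → ℝ) : ℝ :=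
  fderiv ℝ f x (Pi.single K 1)

/-- The standard permutation symbol `ε_{ijk}` on `Fin 3`. -/
noncomputable def eps (i j k : Fin 3) : ℝ :=
  (((j : ℕ) : ℝ) - ((i : ℕ) : ℝ)) * (((k : ℕ) : ℝ) - ((i : ℕ) : ℝ)) *
    (((k : ℕ) : ℝ) - ((j : ℕ) : ℝ)) / 2

universe u

open scoped ContDiff Manifold Topology

theorem two_le_infty : (2 : WithTop ℕ∞) ≤ ∞ := WithTop.coe_le_coe.2 le_top

theorem exists_continuous_radius_ball_subset {E : Type*} [PseudoMetricSpace E] {B : Set E}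
    (hB : IsOpen B) :
    ∃ ε : E → ℝ, Continuous ε ∧ ∀ x ∈ B, 0 < ε x ∧ Metric.ball x (ε x) ⊆ B := by
  rcases Set.eq_empty_or_nonempty Bᶜ with h | h
  · refine ⟨fun _ => 1, continuous_const, fun x _ => ⟨one_pos, ?_⟩⟩
    simp [Set.compl_empty_iff.1 h]
  · refine ⟨fun x => Metric.infDist x Bᶜ, Metric.continuous_infDist_pt _, fun x hx => ⟨?_, ?_⟩⟩
    · exact (hB.isClosed_compl.notMem_iff_infDist_pos h).1 (by simpa using hx)
    · simpa using Metric.ball_infDist_compl_subset (s := B) (x := x)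

/-- An open contractible subset of a finite-dimensional space is smoothly contractible. -/
theorem exists_contDiffOn_contraction {E : Type*} [NormedAddCommGroup E] [NormedSpace ℝ E]
    [FiniteDimensional ℝ E] {B : Set E} (hB : IsOpen B) (hc : ContractibleSpace B) :
    ∃ (H : E × ℝ → E) (c : E), ContDiffOn ℝ ∞ H (B ×ˢ Set.univ) ∧
      (∀ x ∈ B, ∀ t, H (x, t) ∈ B) ∧ (∀ x ∈ B, H (x, 0) = x) ∧ ∀ x ∈ B, H (x, 1) = c := by
  classical
  obtain ⟨ε, hεc, hε⟩ := exists_continuous_radius_ball_subset hB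
  obtain ⟨c, ⟨F⟩⟩ := id_nullhomotopic B
  let M : TopologicalSpace.Opens (E × ℝ) := ⟨B ×ˢ Set.univ, hB.prod isOpen_univ⟩
  let f : M → E := fun p =>
    F (Set.projIcc 0 1 zero_le_one (3 * p.1.2 - 1), ⟨p.1.1, p.2.1⟩)
  have hf : Continuous f := by
    refine continuous_subtype_val.comp (F.continuous.comp (Continuous.prodMk ?_ ?_))
    · exact continuous_projIcc.comp (by fun_prop)
    · exact Continuous.subtype_mk (by fun_prop) _
  have hfB (p : M) : f p ∈ B := Subtype.property _
  have hf0 (p : M) (hp : p.1.2 < 1 / 3) : f p = p.1.1 := by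
    simp only [f]
    rw [Set.projIcc_of_le_left _ (by linarith)]
    simp
  have hf1 (p : M) (hp : 2 / 3 < p.1.2) : f p = c := by
    simp only [f]
    rw [Set.projIcc_of_right_le _ (by linarith)]
    simp
  have ht : Continuous fun p : M => p.1.2 := by fun_prop
  have hS : IsClosed {p : M | p.1.2 ≤ 1 / 4 ∨ 3 / 4 ≤ p.1.2} :=
    (isClosed_le ht continuous_const).union (isClosed_le continuous_const ht)
  have hU0 : IsOpen {p : M | p.1.2 < 1 / 3} := isOpen_lt ht continuous_const
  have hU1 : IsOpen {p : M | 2 / 3 < p.1.2} := isOpen_lt continuous_const ht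
  have hU : {p : M | p.1.2 < 1 / 3} ∪ {p : M | 2 / 3 < p.1.2} ∈
      𝓝ˢ {p : M | p.1.2 ≤ 1 / 4 ∨ 3 / 4 ≤ p.1.2} := by
    refine (hU0.union hU1).mem_nhdsSet.2 ?_
    rintro p (hp | hp)
    · exact Or.inl (lt_of_le_of_lt hp (by norm_num))
    · exact Or.inr (lt_of_lt_of_le (by norm_num) hp)
  have hfU : ContMDiffOn 𝓘(ℝ, E × ℝ) 𝓘(ℝ, E) ∞ f
      ({p : M | p.1.2 < 1 / 3} ∪ {p : M | 2 / 3 < p.1.2}) := by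
    refine ContMDiffOn.union_of_isOpen ?_ ?_ hU0 hU1
    · refine ContMDiffOn.congr (f := fun p : M => p.1.1) ?_ hf0
      exact (contDiff_fst.contMDiff.comp contMDiff_subtype_val).contMDiffOn
    · exact (contMDiffOn_const (c := (c : E))).congr hf1
  have : LocallyCompactSpace M := M.2.locallyCompactSpace
  have : SigmaCompactSpace M := inferInstance
  obtain ⟨g, hg, hgS, -⟩ := hf.exists_contMDiff_approx_and_eqOn 𝓘(ℝ, E × ℝ) ⊤
    (hεc.comp hf) (fun p => (hε _ (hfB p)).1) hS hU hfU
  let H : E × ℝ → E := fun p => if hp : p ∈ M then g ⟨p, hp⟩ else 0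
  have hH (p : M) : H p = g p := dif_pos p.2
  refine ⟨H, c, ?_, ?_, ?_, ?_⟩
  · intro p hp
    have : ContMDiffAt 𝓘(ℝ, E × ℝ) 𝓘(ℝ, E) ∞ (fun q : M => H q) ⟨p, hp⟩ := by
      simp only [hH]
      exact g.contMDiff.contMDiffAt
    exact (contMDiffAt_subtype_iff.1 this).contDiffAt.contDiffWithinAt
  · intro x hx t
    have := hH ⟨(x, t), hx, trivial⟩
    rw [this]
    exact (hε _ (hfB _)).2 (hg ⟨(x, t), hx, trivial⟩)
  · intro x hx
    rw [hH ⟨(x, 0), hx, trivial⟩, hgS (Or.inl (by norm_num)), hf0 _ (by norm_num)]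
  · intro x hx
    rw [hH ⟨(x, 1), hx, trivial⟩, hgS (Or.inr (by norm_num)), hf1 _ (by norm_num)]

theorem hasFDerivAt_intervalIntegral_of_contDiffOn {E G : Type*} [NormedAddCommGroup E]
    [NormedSpace ℝ E] [FiniteDimensional ℝ E] [NormedAddCommGroup G] [NormedSpace ℝ G]
    {B : Set E} (hB : IsOpen B) {f : E × ℝ → G}
    (hf : ContDiffOn ℝ 1 f (B ×ˢ Set.univ)) {x : E} (hx : x ∈ B) :
    HasFDerivAt (fun y => ∫ t in (0 : ℝ)..1, f (y, t))
      (∫ t in (0 : ℝ)..1, (fderiv ℝ f (x, t)).comp (.inl ℝ E ℝ)) x := by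
  have hO : IsOpen (B ×ˢ (Set.univ : Set ℝ)) := hB.prod isOpen_univ
  have hmk (y : E) : Continuous fun t : ℝ => (y, t) := by fun_prop
  have hfc {y : E} (hy : y ∈ B) : Continuous fun t : ℝ => f (y, t) :=
    hf.continuousOn.comp_continuous (hmk y) fun t => ⟨hy, trivial⟩
  have hf' : ContinuousOn (fun p => (fderiv ℝ f p).comp (.inl ℝ E ℝ)) (B ×ˢ Set.univ) :=
    (hf.continuousOn_fderiv_of_isOpen hO le_rfl).clm_comp continuousOn_const
  obtain ⟨r, hr, hrB⟩ := Metric.nhds_basis_closedBall.mem_iff.1 (hB.mem_nhds hx)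
  have hK : IsCompact (Metric.closedBall x r ×ˢ Set.Icc (0 : ℝ) 1) :=
    (isCompact_closedBall x r).prod isCompact_Icc
  obtain ⟨C, hC⟩ := hK.exists_bound_of_continuousOn
    (hf'.mono (Set.prod_mono hrB (Set.subset_univ _)))
  refine intervalIntegral.hasFDerivAt_integral_of_dominated_of_fderiv_le
    (F' := fun y t => (fderiv ℝ f (y, t)).comp (.inl ℝ E ℝ)) (bound := fun _ => C)
    (Metric.closedBall_mem_nhds x hr) ?_ ((hfc hx).intervalIntegrable _ _) ?_ ?_ (by simp) ?_
  · filter_upwards [hB.mem_nhds hx] with y hy using (hfc hy).aestronglyMeasurable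
  · exact (hf'.comp_continuous (hmk x) fun t => ⟨hx, trivial⟩).aestronglyMeasurable
  · refine .of_forall fun t ht y hy => hC (y, t) ⟨hy, ?_⟩
    rw [Set.uIoc_of_le zero_le_one] at ht
    exact Set.Ioc_subset_Icc_self ht
  · refine .of_forall fun t _ y hy => ?_
    have h := ((hf.contDiffAt (hO.mem_nhds ⟨hrB hy, trivial⟩ :
      _ ∈ 𝓝 (y, t))).differentiableAt (by simp)).hasFDerivAt
    exact h.comp y (hasFDerivAt_prodMk_left y t)

theorem contDiffOn_intervalIntegral {E : Type u} [NormedAddCommGroup E]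
    [NormedSpace ℝ E] [FiniteDimensional ℝ E] {B : Set E} (hB : IsOpen B) (n : ℕ) :
    ∀ {G : Type u} [NormedAddCommGroup G] [NormedSpace ℝ G] {f : E × ℝ → G},
      ContDiffOn ℝ ∞ f (B ×ˢ Set.univ) →
      ContDiffOn ℝ n (fun y => ∫ t in (0 : ℝ)..1, f (y, t)) B := by
  have hO : IsOpen (B ×ˢ (Set.univ : Set ℝ)) := hB.prod isOpen_univ
  induction n with
  | zero =>
    intro G _ _ f hf
    refine contDiffOn_zero.2 fun x hx => ?_
    exact (hasFDerivAt_intervalIntegral_of_contDiffOn hB (hf.of_le (by simp)) hx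
      ).continuousAt.continuousWithinAt
  | succ n ih =>
    intro G _ _ f hf
    have hd {x : E} (hx : x ∈ B) :=
      hasFDerivAt_intervalIntegral_of_contDiffOn hB (hf.of_le (by simp)) hx
    push_cast
    rw [contDiffOn_succ_iff_fderiv_of_isOpen hB]
    refine ⟨fun x hx => (hd hx).differentiableAt.differentiableWithinAt, by simp, ?_⟩
    refine ContDiffOn.congr (ih (f := fun p => (fderiv ℝ f p).comp (.inl ℝ E ℝ)) ?_) fun x hx => (hd hx).fderiv
    exact ((hf.fderiv_of_isOpen hO (by simp)).clm_comp contDiffOn_const)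

theorem sum_eps_mul (f : Fin 3 → Fin 3 → Fin 3 → ℝ) :
    ∑ i, ∑ j, ∑ k, eps i j k * f i j k =
      f 0 1 2 + f 1 2 0 + f 2 0 1 - f 0 2 1 - f 1 0 2 - f 2 1 0 := by
  simp only [Fin.sum_univ_three, eps, Fin.val_zero, Fin.val_one, Fin.val_two]
  push_cast
  ring

theorem fderiv_apply_eq_sum_pd {n : ℕ} (f : (Fin n → ℝ) → ℝ) (x v : Fin n → ℝ) :
    fderiv ℝ f x v = ∑ k, pd k f x * v k := by
  conv_lhs => rw [pi_eq_sum_univ' v, map_sum]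
  simp [pd, mul_comm]

/-- The pullback under `H` of the flux two-form of the vector field `V`, evaluated at `u`, `v`. -/
noncomputable def pulledFlux {E : Type*} [NormedAddCommGroup E] [NormedSpace ℝ E]
    (V : (Fin 3 → ℝ) → Fin 3 → ℝ) (H : E → Fin 3 → ℝ) (u v p : E) : ℝ :=
  ∑ i, ∑ j, ∑ k, eps i j k * (V (H p) i * fderiv ℝ H p u j * fderiv ℝ H p v k)

theorem pulledFlux_swap {E : Type*} [NormedAddCommGroup E] [NormedSpace ℝ E]
    (V : (Fin 3 → ℝ) → Fin 3 → ℝ) (H : E → Fin 3 → ℝ) (u v p : E) :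
    pulledFlux V H v u p = - pulledFlux V H u v p := by
  simp only [pulledFlux, sum_eps_mul]
  ring

theorem contDiffOn_pulledFlux {E : Type*} [NormedAddCommGroup E] [NormedSpace ℝ E]
    {V : (Fin 3 → ℝ) → Fin 3 → ℝ} {H : E → Fin 3 → ℝ} {B : Set (Fin 3 → ℝ)} {O : Set E}
    (hO : IsOpen O) (hV : ContDiffOn ℝ ∞ V B) (hH : ContDiffOn ℝ ∞ H O) (hm : Set.MapsTo H O B)
    (u v : E) : ContDiffOn ℝ ∞ (pulledFlux V H u v) O := by
  have h1 (w : E) (j : Fin 3) : ContDiffOn ℝ ∞ (fun p => fderiv ℝ H p w j) O :=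
    contDiffOn_pi.1 ((hH.fderiv_of_isOpen hO (by simp)).clm_apply contDiffOn_const) j
  have h2 (i : Fin 3) : ContDiffOn ℝ ∞ (fun p => V (H p) i) O :=
    contDiffOn_pi.1 (hV.comp hH hm) i
  unfold pulledFlux
  refine .sum fun i _ => .sum fun j _ => .sum fun k _ => ?_
  exact contDiffOn_const.mul (((h2 i).mul (h1 u j)).mul (h1 v k))

/-- The pullback of the flux form of a divergence-free field is closed. -/
theorem fderiv_pulledFlux_cyclic {E : Type*} [NormedAddCommGroup E] [NormedSpace ℝ E]
    {V : (Fin 3 → ℝ) → Fin 3 → ℝ} {H : E → Fin 3 → ℝ} {p : E}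
    (hV : DifferentiableAt ℝ V (H p)) (hH : ContDiffAt ℝ 2 H p)
    (hdiv : ∑ J, pd J (fun y => V y J) (H p) = 0) (u v w : E) :
    fderiv ℝ (pulledFlux V H v w) p u + fderiv ℝ (pulledFlux V H w u) p v +
      fderiv ℝ (pulledFlux V H u v) p w = 0 := by
  have hH1 : DifferentiableAt ℝ H p := hH.differentiableAt (by simp)
  have hH2 : DifferentiableAt ℝ (fderiv ℝ H) p :=
    (hH.fderiv_right (m := 1) (by norm_num)).differentiableAt (by simp)
  set s : E → E → Fin 3 → ℝ := fun a b => fderiv ℝ (fderiv ℝ H) p a b with hs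
  set d : E → Fin 3 → ℝ := fun a => fderiv ℝ H p a with hd
  have hsymm (a b : E) : s a b = s b a := hH.isSymmSndFDerivAt (by simp) a b
  have h1 (b : E) (j : Fin 3) : DifferentiableAt ℝ (fun q => fderiv ℝ H q b j) p :=
    differentiableAt_pi.1 (hH2.clm_apply (differentiableAt_const _)) j
  have h1' (a b : E) (j : Fin 3) : fderiv ℝ (fun q => fderiv ℝ H q b j) p a = s a b j := by
    have := hasFDerivAt_pi'.1 (hH2.hasFDerivAt.clm_apply (hasFDerivAt_const b p)) j
    rw [this.fderiv]
    simp [hs]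
  have hVi (i : Fin 3) : DifferentiableAt ℝ (fun y => V y i) (H p) := differentiableAt_pi.1 hV i
  have h2 (i : Fin 3) : DifferentiableAt ℝ (fun q => V (H q) i) p := (hVi i).comp p hH1
  have h2' (a : E) (i : Fin 3) : fderiv ℝ (fun q => V (H q) i) p a =
      ∑ k, pd k (fun y => V y i) (H p) * d a k := by
    rw [show (fun q => V (H q) i) = (fun y => V y i) ∘ H from rfl,
      fderiv_comp p (hVi i) hH1, ← fderiv_apply_eq_sum_pd]
    rfl
  have key (a b c : E) : fderiv ℝ (pulledFlux V H b c) p a = ∑ i, ∑ j, ∑ k, eps i j k *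
      ((∑ l, pd l (fun y => V y i) (H p) * d a l) * d b j * d c k + V (H p) i * s a b j * d c k
        + V (H p) i * d b j * s a c k) := by
    have : HasFDerivAt (pulledFlux V H b c) _ p :=
      HasFDerivAt.fun_sum fun i _ => HasFDerivAt.fun_sum fun j _ => HasFDerivAt.fun_sum fun k _ =>
        (((h2 i).hasFDerivAt.mul (h1 b j).hasFDerivAt).mul (h1 c k).hasFDerivAt).const_mul _
    rw [this.fderiv]
    simp only [sum_apply, smul_apply,
      add_apply, h1', h2', smul_eq_mul, Pi.mul_apply]
    refine Finset.sum_congr rfl fun i _ => Finset.sum_congr rfl fun j _ =>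
      Finset.sum_congr rfl fun k _ => ?_
    simp only [hd]
    ring
  rw [key, key, key, hsymm v u, hsymm w u, hsymm w v]
  simp only [sum_eps_mul]
  simp only [Fin.sum_univ_three] at hdiv ⊢
  linear_combination (d u 0 * d v 1 * d w 2 + d u 1 * d v 2 * d w 0 + d u 2 * d v 0 * d w 1
    - d u 0 * d v 2 * d w 1 - d u 1 * d v 0 * d w 2 - d u 2 * d v 1 * d w 0) * hdiv

theorem pulledFlux_initial {V : (Fin 3 → ℝ) → Fin 3 → ℝ} {H : (Fin 3 → ℝ) × ℝ → Fin 3 → ℝ}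
    {B : Set (Fin 3 → ℝ)} (hB : IsOpen B) (h0 : ∀ x ∈ B, H (x, 0) = x) {x : Fin 3 → ℝ}
    (hx : x ∈ B) (hH : DifferentiableAt ℝ H (x, 0)) (M N : Fin 3) :
    pulledFlux V H (Pi.single M 1, 0) (Pi.single N 1, 0) (x, 0) = ∑ i, eps i M N * V x i := by
  have h (v : Fin 3 → ℝ) : fderiv ℝ H (x, 0) (v, 0) = v := by
    have h1 : HasFDerivAt (fun y => H (y, 0)) ((fderiv ℝ H (x, 0)).comp (.inl ℝ _ ℝ)) x :=
      hH.hasFDerivAt.comp x (hasFDerivAt_prodMk_left x 0)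
    have h2 : (fun y => H (y, 0)) =ᶠ[𝓝 x] id :=
      Filter.eventually_of_mem (hB.mem_nhds hx) h0
    simpa using DFunLike.congr_fun (h1.unique ((hasFDerivAt_id x).congr_of_eventuallyEq h2)) v
  simp only [pulledFlux, h, h0 x hx]
  refine Finset.sum_congr rfl fun i _ => ?_
  simp [Pi.single_apply]

theorem pulledFlux_final {V : (Fin 3 → ℝ) → Fin 3 → ℝ} {H : (Fin 3 → ℝ) × ℝ → Fin 3 → ℝ}
    {B : Set (Fin 3 → ℝ)} (hB : IsOpen B) {c : Fin 3 → ℝ} (h1 : ∀ x ∈ B, H (x, 1) = c)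
    {x : Fin 3 → ℝ} (hx : x ∈ B) (hH : DifferentiableAt ℝ H (x, 1)) (v w : Fin 3 → ℝ) :
    pulledFlux V H (v, 0) (w, 0) (x, 1) = 0 := by
  have h (v : Fin 3 → ℝ) : fderiv ℝ H (x, 1) (v, 0) = 0 := by
    have h1' : HasFDerivAt (fun y => H (y, 1)) ((fderiv ℝ H (x, 1)).comp (.inl ℝ _ ℝ)) x :=
      hH.hasFDerivAt.comp x (hasFDerivAt_prodMk_left x 1)
    have h2 : (fun y => H (y, 1)) =ᶠ[𝓝 x] fun _ => c :=
      Filter.eventually_of_mem (hB.mem_nhds hx) h1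
    simpa using DFunLike.congr_fun
      (h1'.unique ((hasFDerivAt_const c x).congr_of_eventuallyEq h2)) v
  simp [pulledFlux, h]

/-- On an open contractible subset of `ℝ³`, every smooth divergence-free vector field is a curl. -/
theorem exists_vector_potential {B : Set (Fin 3 → ℝ)} (hB : IsOpen B) (hc : ContractibleSpace B)
    {V : (Fin 3 → ℝ) → Fin 3 → ℝ} (hV : ContDiffOn ℝ ∞ V B)
    (hdiv : ∀ x ∈ B, ∑ J, pd J (fun y => V y J) x = 0) :
    ∃ A : (Fin 3 → ℝ) → Fin 3 → ℝ, ContDiffOn ℝ ∞ A B ∧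
      ∀ x ∈ B, ∀ J, V x J = ∑ M, ∑ N, eps J M N * pd M (fun y => A y N) x := by
  obtain ⟨H, c, hH, hHB, h0, h1⟩ := exists_contDiffOn_contraction hB hc
  have hO : IsOpen (B ×ˢ (Set.univ : Set ℝ)) := hB.prod isOpen_univ
  have hm : Set.MapsTo H (B ×ˢ Set.univ) B := fun p hp => hHB _ hp.1 _
  have hP (u v : (Fin 3 → ℝ) × ℝ) : ContDiffOn ℝ ∞ (pulledFlux V H u v) (B ×ˢ Set.univ) :=
    contDiffOn_pulledFlux hO hV hH hm u v
  let e (N : Fin 3) : (Fin 3 → ℝ) × ℝ := (Pi.single N 1, 0)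
  let τ : (Fin 3 → ℝ) × ℝ := (0, 1)
  have hpO {x : Fin 3 → ℝ} (hx : x ∈ B) (t : ℝ) : B ×ˢ Set.univ ∈ 𝓝 (x, t) :=
    hO.mem_nhds ⟨hx, trivial⟩
  have hHd {x : Fin 3 → ℝ} (hx : x ∈ B) (t : ℝ) : DifferentiableAt ℝ H (x, t) :=
    (hH.contDiffAt (hpO hx t)).differentiableAt (by simp)
  have hcont (u v w : (Fin 3 → ℝ) × ℝ) {x : Fin 3 → ℝ} (hx : x ∈ B) :
      Continuous fun t : ℝ => fderiv ℝ (pulledFlux V H u v) (x, t) w :=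
    (((hP u v).continuousOn_fderiv_of_isOpen hO (by simp)).clm_apply
      continuousOn_const).comp_continuous (by fun_prop) fun t => ⟨hx, trivial⟩
  have hpd (M N : Fin 3) {x : Fin 3 → ℝ} (hx : x ∈ B) :
      pd M (fun y => ∫ t in (0 : ℝ)..1, pulledFlux V H (e N) τ (y, t)) x =
        ∫ t in (0 : ℝ)..1, fderiv ℝ (pulledFlux V H (e N) τ) (x, t) (e M) := by
    rw [pd, (hasFDerivAt_intervalIntegral_of_contDiffOn hB ((hP _ _).of_le (by simp)) hx).fderiv,
      ContinuousLinearMap.intervalIntegral_apply]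
    · rfl
    · refine Continuous.intervalIntegrable ?_ _ _
      exact ((((hP (e N) τ).continuousOn_fderiv_of_isOpen hO (by simp)).clm_comp
        continuousOn_const).comp_continuous (by fun_prop) fun t => ⟨hx, trivial⟩)
  have hcurl (M N : Fin 3) {x : Fin 3 → ℝ} (hx : x ∈ B) :
      pd M (fun y => ∫ t in (0 : ℝ)..1, pulledFlux V H (e N) τ (y, t)) x -
        pd N (fun y => ∫ t in (0 : ℝ)..1, pulledFlux V H (e M) τ (y, t)) x =
        ∑ i, eps i M N * V x i := by
    have hder (t : ℝ) : HasDerivAt (fun t => pulledFlux V H (e M) (e N) (x, t))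
        (fderiv ℝ (pulledFlux V H (e M) (e N)) (x, t) τ) t :=
      (((hP _ _).contDiffAt (hpO hx t)).differentiableAt (by simp)).hasFDerivAt.comp_hasDerivAt t
        ((hasDerivAt_const t x).prodMk (hasDerivAt_id t))
    have hftc := intervalIntegral.integral_eq_sub_of_hasDerivAt (a := 0) (b := 1)
      (fun t _ => hder t) ((hcont _ _ _ hx).intervalIntegrable _ _)
    rw [pulledFlux_initial hB h0 hx (hHd hx 0), pulledFlux_final hB h1 hx (hHd hx 1)] at hftc
    rw [hpd M N hx, hpd N M hx, ← intervalIntegral.integral_sub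
      ((hcont _ _ _ hx).intervalIntegrable _ _) ((hcont _ _ _ hx).intervalIntegrable _ _),
      ← neg_eq_iff_eq_neg.2 (hftc.trans (zero_sub _)), ← intervalIntegral.integral_neg]
    refine intervalIntegral.integral_congr fun t _ => ?_
    have hcyc := fderiv_pulledFlux_cyclic (u := e M) (v := e N) (w := τ)
      ((hV.contDiffAt (hB.mem_nhds (hHB x hx t))).differentiableAt (by simp))
      ((hH.contDiffAt (hpO hx t)).of_le two_le_infty) (hdiv _ (hHB x hx t))
    have hsw : pulledFlux V H τ (e M) = -pulledFlux V H (e M) τ :=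
      funext fun p => pulledFlux_swap V H _ _ p
    rw [hsw, fderiv_neg, neg_apply] at hcyc
    linarith
  refine ⟨fun x N => ∫ t in (0 : ℝ)..1, pulledFlux V H (e N) τ (x, t), ?_, fun x hx J => ?_⟩
  · exact contDiffOn_pi.2 fun N => contDiffOn_infty.2 fun n =>
      contDiffOn_intervalIntegral hB n (hP _ _)
  · have h01 := hcurl 0 1 hx
    have h12 := hcurl 1 2 hx
    have h20 := hcurl 2 0 hx
    fin_cases J <;> simp [Fin.sum_univ_three, eps] at h01 h12 h20 ⊢ <;> linarith

section PartialDerivatives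

variable {n : ℕ} {B : Set (Fin n → ℝ)} {f g : (Fin n → ℝ) → ℝ} {x : Fin n → ℝ}

theorem pd_congr (hB : IsOpen B) (h : Set.EqOn f g B) (hx : x ∈ B) (K : Fin n) :
    pd K f x = pd K g x := by
  rw [pd, (Filter.eventuallyEq_of_mem (hB.mem_nhds hx) h).fderiv_eq, pd]

theorem contDiffOn_pd (hB : IsOpen B) (hf : ContDiffOn ℝ ∞ f B) (K : Fin n) :
    ContDiffOn ℝ ∞ (pd K f) B :=
  (hf.fderiv_of_isOpen hB (by simp)).clm_apply contDiffOn_const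

theorem pd_comm (hB : IsOpen B) (hf : ContDiffOn ℝ ∞ f B) (hx : x ∈ B) (K M : Fin n) :
    pd K (pd M f) x = pd M (pd K f) x := by
  have hd : DifferentiableAt ℝ (fderiv ℝ f) x :=
    ((hf.fderiv_of_isOpen hB (m := ∞) (by simp)).contDiffAt
      (hB.mem_nhds hx)).differentiableAt (by simp)
  have h (K M : Fin n) : pd K (pd M f) x =
      fderiv ℝ (fderiv ℝ f) x (Pi.single K 1) (Pi.single M 1) := by
    have := hd.hasFDerivAt.clm_apply (hasFDerivAt_const (Pi.single M (1 : ℝ)) x)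
    rw [pd, show pd M f = fun y => fderiv ℝ f y (Pi.single M 1) from rfl, this.fderiv]
    simp
  rw [h, h]
  exact ((hf.contDiffAt (hB.mem_nhds hx)).isSymmSndFDerivAt
    (by simpa using two_le_infty)) _ _

theorem pd_add (hB : IsOpen B) (hf : ContDiffOn ℝ ∞ f B) (hg : ContDiffOn ℝ ∞ g B) (hx : x ∈ B)
    (K : Fin n) : pd K (fun y => f y + g y) x = pd K f x + pd K g x := by
  rw [pd, fderiv_fun_add ((hf.contDiffAt (hB.mem_nhds hx)).differentiableAt (by simp))
    ((hg.contDiffAt (hB.mem_nhds hx)).differentiableAt (by simp))]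
  rfl

theorem pd_const_mul (hB : IsOpen B) (hf : ContDiffOn ℝ ∞ f B) (hx : x ∈ B) (c : ℝ)
    (K : Fin n) : pd K (fun y => c * f y) x = c * pd K f x := by
  rw [pd, fderiv_const_mul ((hf.contDiffAt (hB.mem_nhds hx)).differentiableAt (by simp))]
  rfl

theorem pd_sum {ι : Type*} (s : Finset ι) {F : ι → (Fin n → ℝ) → ℝ} (hB : IsOpen B)
    (hF : ∀ i ∈ s, ContDiffOn ℝ ∞ (F i) B) (hx : x ∈ B) (K : Fin n) :
    pd K (fun y => ∑ i ∈ s, F i y) x = ∑ i ∈ s, pd K (F i) x := by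
  rw [pd, fderiv_fun_sum fun i hi =>
    ((hF i hi).contDiffAt (hB.mem_nhds hx)).differentiableAt (by simp)]
  simp [pd]

end PartialDerivatives

/-- On an open contractible `B ⊆ ℝ³`, every smooth symmetric divergence-free
(²₀)-tensor field `T` admits a Beltrami stress function: a smooth symmetric `Φ` with
`T^{IJ} = ε_{IKL} ε_{JMN} ∂_K ∂_M Φ^{LN}`. -/
theorem beltrami_stress_function_exists
    (B : Set (Fin 3 → ℝ)) (hB : IsOpen B) (hc : ContractibleSpace B)
    (T : (Fin 3 → ℝ) → Fin 3 → Fin 3 → ℝ)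
    (hT : ContDiffOn ℝ (⊤ : ℕ∞) T B)
    (hsym : ∀ x ∈ B, ∀ I J, T x I J = T x J I)
    (hdiv : ∀ x ∈ B, ∀ I, (∑ J, pd J (fun y => T y I J) x) = 0) :
    ∃ Φ : (Fin 3 → ℝ) → Fin 3 → Fin 3 → ℝ,
      ContDiffOn ℝ (⊤ : ℕ∞) Φ B ∧
      (∀ x ∈ B, ∀ I J, Φ x I J = Φ x J I) ∧
      ∀ x ∈ B, ∀ I J,
        T x I J = ∑ K, ∑ L, ∑ M, ∑ N, eps I K L * eps J M N *
          pd K (fun y => pd M (fun z => Φ z L N) y) x := by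
  choose A hA hTA using fun I => exists_vector_potential hB hc (contDiffOn_pi.1 hT I)
    fun x hx => hdiv x hx I
  have hAc (I P : Fin 3) : ContDiffOn ℝ ∞ (fun y => A I y P) B := contDiffOn_pi.1 (hA I) P
  have htr : ContDiffOn ℝ ∞ (fun y => ∑ N, A N y N) B := .sum fun N _ => hAc N N
  let δ (I P : Fin 3) : ℝ := if I = P then -1 else 0
  have hWc (I P : Fin 3) : ContDiffOn ℝ ∞ (fun y => A I y P + δ I P * ∑ N, A N y N) B :=
    (hAc I P).add (contDiffOn_const.mul htr)
  have hWpd (K I P : Fin 3) {x : Fin 3 → ℝ} (hx : x ∈ B) :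
      pd K (fun y => A I y P + δ I P * ∑ N, A N y N) x =
        pd K (fun y => A I y P) x + δ I P * ∑ N, pd K (fun y => A N y N) x := by
    rw [pd_add hB (hAc I P) (contDiffOn_const.mul htr) hx, pd_const_mul hB htr hx,
      pd_sum _ hB (fun N _ => hAc N N) hx]
  have hWdiv (P : Fin 3) (x : Fin 3 → ℝ) (hx : x ∈ B) :
      ∑ I, pd I (fun y => A I y P + δ I P * ∑ N, A N y N) x = 0 := by
    simp only [hWpd _ _ _ hx]
    have h01 := hsym x hx 0 1
    have h12 := hsym x hx 1 2
    have h20 := hsym x hx 2 0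
    simp only [hTA _ x hx] at h01 h12 h20
    fin_cases P <;> simp [Fin.sum_univ_three, eps, δ] at h01 h12 h20 ⊢ <;> linarith
  choose Ψ hΨ hWΨ using fun P => exists_vector_potential hB hc
    (V := fun y I => A I y P + δ I P * ∑ N, A N y N) (contDiffOn_pi.2 fun I => hWc I P) (hWdiv P)
  have hΨc (N L : Fin 3) : ContDiffOn ℝ ∞ (fun y => Ψ N y L) B := contDiffOn_pi.1 (hΨ N) L
  have hΨc' (K N L : Fin 3) : ContDiffOn ℝ ∞ (pd K fun y => Ψ N y L) B :=
    contDiffOn_pd hB (hΨc N L) K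
  refine ⟨fun x L N => 1 / 2 * (Ψ N x L + Ψ L x N), ?_, fun x _ I J => by ring,
    fun x hx I J => ?_⟩
  · exact contDiffOn_pi.2 fun L => contDiffOn_pi.2 fun N =>
      contDiffOn_const.mul ((hΨc N L).add (hΨc L N))
  let q (K M L N : Fin 3) : ℝ := pd K (pd M fun z => Ψ N z L) x
  have hq (K M L N : Fin 3) : q K M L N = q M K L N := pd_comm hB (hΨc N L) hx K M
  have hΦ (K M L N : Fin 3) :
      pd K (fun y => pd M (fun z => 1 / 2 * (Ψ N z L + Ψ L z N)) y) x =
        1 / 2 * (q K M L N + q K M N L) := by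
    rw [pd_congr hB (g := fun y => 1 / 2 * (pd M (fun z => Ψ N z L) y + pd M (fun z => Ψ L z N) y))
      (fun y hy => ?_) hx, pd_const_mul hB ((hΨc' M N L).add (hΨc' M L N)) hx,
      pd_add hB (hΨc' M N L) (hΨc' M L N) hx]
    simp only
    rw [pd_const_mul hB ((hΨc N L).add (hΨc L N)) hy, pd_add hB (hΨc N L) (hΨc L N) hy]
  have hWq (M N I : Fin 3) : pd M (fun y => A I y N) x + δ I N * ∑ P, pd M (fun y => A P y P) x =
      ∑ K, ∑ L, eps I K L * q M K L N := by
    rw [← hWpd M I N hx, pd_congr hB (fun y hy => hWΨ N y hy I) hx,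
      pd_sum _ hB (fun K _ => .sum fun L _ => contDiffOn_const.mul (hΨc' K N L)) hx]
    refine Finset.sum_congr rfl fun K _ => ?_
    rw [pd_sum _ hB (fun L _ => contDiffOn_const.mul (hΨc' K N L)) hx]
    exact Finset.sum_congr rfl fun L _ => pd_const_mul hB (hΨc' K N L) hx _ _
  let θ (M : Fin 3) : ℝ := ∑ P, pd M (fun y => A P y P) x
  let R (I J : Fin 3) : ℝ := ∑ K, ∑ L, ∑ M, ∑ N, eps I K L * eps J M N * q M K L N
  have hR (I J : Fin 3) : R I J = T x I J + ∑ M, ∑ N, eps J M N * (δ I N * θ M) := by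
    have h : R I J = ∑ M, ∑ N, eps J M N * ∑ K, ∑ L, eps I K L * q M K L N := by
      simp only [R, Fin.sum_univ_three]
      ring
    rw [h, hTA I x hx J, ← Finset.sum_add_distrib]
    refine Finset.sum_congr rfl fun M _ => ?_
    rw [← Finset.sum_add_distrib]
    refine Finset.sum_congr rfl fun N _ => ?_
    rw [← hWq, mul_add]
  have hanti : ∑ M, ∑ N, eps J M N * (δ I N * θ M) = -∑ M, ∑ N, eps I M N * (δ J N * θ M) := by
    fin_cases I <;> fin_cases J <;> simp [Fin.sum_univ_three, eps, δ] <;> ring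
  have hsum : ∑ K, ∑ L, ∑ M, ∑ N, eps I K L * eps J M N * (1 / 2 * (q K M L N + q K M N L)) =
      1 / 2 * (R I J + R J I) := by
    have h : R I J = ∑ K, ∑ L, ∑ M, ∑ N, eps I K L * eps J M N * q K M L N :=
      Finset.sum_congr rfl fun K _ => Finset.sum_congr rfl fun L _ =>
        Finset.sum_congr rfl fun M _ => Finset.sum_congr rfl fun N _ => by rw [hq]
    rw [h]
    simp only [R, Fin.sum_univ_three]
    ring
  simp only [hΦ]
  rw [hsum, hR, hR, hanti, ← hsym x hx I J]
  ring
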